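/- Let r be a real number with 1/√2 < r ≤ 1. The supremum, over all 5-tuples of points P₁, P₂, P₃, P₄, P₅ in the Euclidean plane satisfying d(P₅, Pᵢ) ≤ r for i = 1,2,3,4 and d(Pᵢ, Pⱼ) ≤ 1 for 1 ≤ i < j ≤ 4, of the area of the convex hull of {P₁, P₂, P₃, P₄, P₅} equals the maximum of A(r,x) over x ∈ [0, 1/2]. -/

import Mathlib

open MeasureTheory Metric Set

/-- `A r x = (1/2)·x·√(3 − 4x − 4x²) + (1/2)·√(r² − x²)`. -/
noncomputable def A (r x : ℝ) : ℝ :=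
  1 / 2 * x * Real.sqrt (3 - 4 * x - 4 * x ^ 2) + 1 / 2 * Real.sqrt (r ^ 2 - x ^ 2)


lemma half_le_M {r M : ℝ} (hr : 1 / 2 < r ^ 2)
    (hM : ∀ t, 0 ≤ t → t ≤ 1 / 2 → t * √(1 - (t + 1/2)^2) + 1/2 * √(r^2 - t^2) ≤ M) :
    9/50 + 1/2 * √(r^2 - 9/100) ≤ M ∧ 1/2 ≤ M := by
  have h := hM (3/10) (by norm_num) (by norm_num)
  have e : √(1 - ((3:ℝ)/10 + 1/2)^2) = 3/5 := by
    rw [show (1 - ((3:ℝ)/10 + 1/2)^2) = (3/5)^2 by norm_num]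
    exact Real.sqrt_sq (by norm_num)
  rw [e] at h
  have h2 : 9/50 + 1/2 * √(r^2 - 9/100) ≤ M := by
    have : r^2 - ((3:ℝ)/10)^2 = r^2 - 9/100 := by norm_num
    rw [this] at h; linarith
  refine ⟨h2, ?_⟩
  have : (16/25 : ℝ) ≤ √(r^2 - 9/100) := Real.le_sqrt_of_sq_le (by nlinarith)
  linarith

lemma r_half_le_M {r M : ℝ} (hr0 : 0 < r)
    (hM : ∀ t, 0 ≤ t → t ≤ 1 / 2 → t * √(1 - (t + 1/2)^2) + 1/2 * √(r^2 - t^2) ≤ M) :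
    r / 2 ≤ M := by
  have h := hM 0 le_rfl (by norm_num)
  have e : √(r^2 - 0^2) = r := by rw [show r^2 - 0^2 = r^2 by ring]; exact Real.sqrt_sq hr0.le
  rw [e] at h; linarith

/-- the small tilt case -/
lemma caseI {r M w k c Y h L : ℝ} (hr0 : 0 < r) (hr : 1 / 2 < r ^ 2)
    (hM : ∀ t, 0 ≤ t → t ≤ 1 / 2 → t * √(1 - (t + 1/2)^2) + 1/2 * √(r^2 - t^2) ≤ M)
    (hw0 : 0 ≤ w) (hw1 : w ≤ 1/2) (hk : 0 ≤ k) (hc0 : 0 ≤ c) (hc1 : c ≤ 1)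
    (hL : L^2 = k^2 + w^2 + 2 * k * w * c) (hL0 : 0 ≤ L) (hL1 : L ≤ 1) (hY : Y = √(1 - L^2))
    (hh : h ≤ c * √(r^2 - k^2)) : w * h + k * Y ≤ M := by
  obtain ⟨-, hMhalf⟩ := half_le_M hr hM
  have hMr := r_half_le_M hr0 hM
  set g := √(r^2 - k^2) with hg
  have hg0 : 0 ≤ g := Real.sqrt_nonneg _
  have hgr : g ≤ r := by
    rw [hg]; apply Real.sqrt_le_iff.2; exact ⟨hr0.le, by nlinarith⟩
  have hY0 : 0 ≤ Y := hY ▸ Real.sqrt_nonneg _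
  have hY2 : Y^2 = 1 - L^2 := by rw [hY]; exact Real.sq_sqrt (by nlinarith)
  have hLlow : k + w * c ≤ L := by
    apply abs_le_of_sq_le_sq' _ hL0 |>.2
    nlinarith [mul_nonneg (mul_nonneg hw0 hw0) (sub_nonneg.2 hc1), mul_nonneg (mul_nonneg (mul_nonneg hw0 hw0) hc0) (sub_nonneg.2 hc1)]
  have hLup : L ≤ k + w := by
    apply abs_le_of_sq_le_sq' _ (by positivity) |>.2
    nlinarith [mul_nonneg (mul_nonneg hk hw0) (sub_nonneg.2 hc1)]
  have hwh : w * h ≤ w * c * g := by nlinarith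
  have hwc : 0 ≤ w * c := mul_nonneg hw0 hc0
  rcases le_total g Y with hgY | hgY
  · have : w * c * g ≤ w * c * Y := mul_le_mul_of_nonneg_left hgY hwc
    have h3 : (k + w * c) * Y ≤ L * Y := mul_le_mul_of_nonneg_right hLlow hY0
    nlinarith [sq_nonneg (L - Y)]
  · rcases le_total (1/2) L with hl | hl
    · have h1 := hM (L - 1/2) (by linarith) (by linarith)
      rw [show L - 1/2 + 1/2 = L by ring, ← hY] at h1
      have h2 : g ≤ √(r^2 - (L-1/2)^2) := Real.sqrt_le_sqrt (by
        have : (L - 1/2)^2 ≤ k^2 := pow_le_pow_left₀ (by linarith) (by linarith) 2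
        linarith)
      have h3 : (k + 1/2 - L) * Y ≤ (k + 1/2 - L) * g := mul_le_mul_of_nonneg_left hgY (by linarith)
      have h4 : (k + w * c) * g ≤ L * g := mul_le_mul_of_nonneg_right hLlow hg0
      nlinarith
    · have h3 : k * Y ≤ k * g := mul_le_mul_of_nonneg_left hgY hk
      have h4 : (k + w * c) * g ≤ L * g := mul_le_mul_of_nonneg_right hLlow hg0
      have h5 : L * g ≤ 1/2 * r := mul_le_mul hl hgr hg0 (by norm_num)
      nlinarith

lemma arc {q v x α β v1 : ℝ} (hq : q = x^2 + v^2) (hx : 0 ≤ x) (hv : q ≤ v) (hα : 0 < α)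
    (hβ : 0 < β) (h1 : (α * v1 - α * q)^2 ≤ β^2 * (q - q^2)) (h2 : v1^2 ≤ q) :
    α * v1 ≤ α * v + β * x := by
  by_contra hcon
  push Not at hcon
  have hbx : 0 ≤ β * x := by positivity
  have hv1 : v < v1 := by
    have : α * v < α * v1 := by linarith
    exact lt_of_mul_lt_mul_left this hα.le
  have h3 : (β * x)^2 < (α * (v1 - v))^2 := pow_lt_pow_left₀ (by linarith) hbx (by norm_num)
  have h4 : (β * x)^2 = β^2 * (q - v^2) := by rw [hq]; ring
  rw [h4] at h3
  have h5 : (v1 - q) * (β^2 * (q - v^2) - (α * (v1 - v))^2) =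
      (v1 - v) * (β^2 * (q - q^2) - (α * v1 - α * q)^2) + (v - q) * (β^2 * (q - v1^2))
      + (α^2 + β^2) * ((v - q) * (v1 - v) * (v1 - q)) := by ring
  have h6 : 0 ≤ (v1 - v) * (β^2 * (q - q^2) - (α * v1 - α * q)^2) :=
    mul_nonneg (by linarith) (by linarith)
  have h7 : 0 ≤ (v - q) * (β^2 * (q - v1^2)) :=
    mul_nonneg (by linarith) (mul_nonneg (by positivity) (by linarith))
  have h8 : 0 ≤ (α^2 + β^2) * ((v - q) * (v1 - v) * (v1 - q)) :=
    mul_nonneg (by positivity) (mul_nonneg (mul_nonneg (by linarith) (by linarith)) (by linarith))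
  have h9 : (v1 - q) * (β^2 * (q - v^2) - (α * (v1 - v))^2) < 0 :=
    mul_neg_of_pos_of_neg (by linarith) (by linarith)
  linarith

lemma aux1 {q : ℝ} (h1 : 1/25 ≤ q) (h2 : q ≤ 9/100) :
    (1/2 * (2 * (105/100*q + 412/100000)) - 1/2 * q)^2 ≤ (1/5)^2 * (q - q^2) ∧
    (2 * (105/100*q + 412/100000))^2 ≤ q := by
  constructor <;> nlinarith [mul_nonneg (sub_nonneg.2 h1) (sub_nonneg.2 h2)]

lemma aux2 {q : ℝ} (h1 : 9/100 ≤ q) (h2 : q ≤ 1/4) :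
    (1/2 * (2 * (75/100*q + 4175/100000)) - 1/2 * q)^2 ≤ (1/4)^2 * (q - q^2) ∧
    (2 * (75/100*q + 4175/100000))^2 ≤ q := by
  constructor <;> nlinarith [mul_nonneg (sub_nonneg.2 h1) (sub_nonneg.2 h2)]

lemma caseII {r M w x v k Y h : ℝ} (hr0 : 0 < r) (hr : 1 / 2 < r ^ 2) (hr1 : r ≤ 1)
    (hM : ∀ t, 0 ≤ t → t ≤ 1 / 2 → t * √(1 - (t + 1/2)^2) + 1/2 * √(r^2 - t^2) ≤ M)
    (hw0 : 0 ≤ w) (hw1 : w ≤ 1/2) (hx : 0 ≤ x) (hv : 0 ≤ v) 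
    (hk2 : k^2 = x^2 + v^2) (hk1 : k^2 ≤ 1/4)
    (hY2 : Y^2 = 1 - (k^2 + w^2 + 2 * x * w))
    (hhr : h + v ≤ r) (hhv : x^2 < h * v) : w * h + k * Y ≤ M := by
  obtain ⟨hM3, -⟩ := half_le_M hr hM
  have hr7 : (7071/10000 : ℝ) ≤ r := by nlinarith
  have hg : 107/100 * r - 1167/10000 ≤ √(r^2 - 9/100) := Real.le_sqrt_of_sq_le (by nlinarith)
  have hvk : k^2 ≤ v := by nlinarith
  have hwh : w * h ≤ w * (r - v) := mul_le_mul_of_nonneg_left (by linarith) hw0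
  have key : ∀ l : ℝ, 0 < l → k * Y ≤ l / 2 * k^2 + Y^2 / (2 * l) := by
    intro l hl
    have : l / 2 * k^2 + Y^2 / (2 * l) - k * Y = (l * k - Y)^2 / (2 * l) := by field_simp; ring
    have h2 : 0 ≤ (l * k - Y)^2 / (2 * l) := by positivity
    linarith
  have hxk : x ≤ 1/2 := by nlinarith
  have hvk1 : v ≤ 1/2 := by nlinarith
  have hww : 9/10 * w - 81/400 ≤ w^2 := by nlinarith [sq_nonneg (w - 9/20)]
  suffices w * (r - v) + k * Y ≤ 107/200 * r + 12165/100000 by linarith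
  have lin : ∀ a b : ℝ, a ≤ 0 → a + b/2 ≤ 0 → a + b * w ≤ 0 := by
    intro a b h1 h2
    nlinarith
  rcases le_total (k^2) (1/25) with h1 | h1
  · have h3 := key (7/2) (by norm_num)
    rw [hY2] at h3
    have hxv : 5 * k^2 ≤ x + v := by
      have : (x + v)^2 ≥ k^2 := by nlinarith
      by_contra hcon
      push Not at hcon
      have : (x+v)^2 < (5 * k^2)^2 := pow_lt_pow_left₀ hcon (by positivity) (by norm_num)
      nlinarith
    have := lin (7/4*k^2 + (1 - k^2 + 81/400)/7 - 107/200*r - 12165/100000) (r - v - 2*x/7 - 9/70)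
      (by linarith) (by linarith)
    linarith
  · rcases le_total (k^2) (9/100) with h2 | h2
    · have h3 := key (5/2) (by norm_num)
      rw [hY2] at h3
      have h4 := arc (q := k^2) (α := 1/2) (β := 1/5) (v1 := 2 * (105/100*k^2 + 412/100000)) hk2 hx hvk
        (by norm_num) (by norm_num) (aux1 h1 h2).1 (aux1 h1 h2).2
      have := lin (5/4*k^2 + (1 - k^2 + 81/400)/5 - 107/200*r - 12165/100000) (r - v - 2*x/5 - 9/50)
        (by linarith) (by linarith)
      linarith
    · have h3 := key 2 (by norm_num)
      rw [hY2] at h3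
      have h4 := arc (q := k^2) (α := 1/2) (β := 1/4) (v1 := 2 * (75/100*k^2 + 4175/100000)) hk2 hx hvk
        (by norm_num) (by norm_num) (aux2 h2 hk1).1 (aux2 h2 hk1).2
      have := lin (k^2 + (1 - k^2 + 81/400)/4 - 107/200*r - 12165/100000) (r - v - 2*x/4 - 9/40)
        (by linarith) (by linarith)
      linarith

set_option maxHeartbeats 1000000 in
lemma core {r M w x v y h δ s : ℝ} (hr0 : 0 < r) (hr : 1 / 2 < r ^ 2) (hr1 : r ≤ 1)
    (hM : ∀ t, 0 ≤ t → t ≤ 1 / 2 → t * √(1 - (t + 1/2)^2) + 1/2 * √(r^2 - t^2) ≤ M)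
    (hw0 : 0 ≤ w) (hw1 : w ≤ 1/2) (hv : 0 ≤ v) (hbc : x^2 + v^2 ≤ 1/4)
    (hac : (x + w - δ)^2 + (y + v)^2 ≤ 1) (hbd : (x + w + δ)^2 + (y - v)^2 ≤ 1)
    (hec : (s - x)^2 + (h + v)^2 ≤ r^2) (heb : (s + x)^2 + (h - v)^2 ≤ r^2)
    (hcd : (δ + w - x)^2 + (y + v)^2 ≤ 1) (hhy : y ≤ h) (hyv : v ≤ y) :
    x * y + v * δ + w * h ≤ M := by
  have hMr := r_half_le_M hr0 hM
  have hhr : h + v ≤ r := abs_le_of_sq_le_sq' (by nlinarith [sq_nonneg (s - x)]) hr0.le |>.2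
  rcases le_total x 0 with hx | hx
  · have h1 : x * y ≤ 0 := mul_nonpos_of_nonpos_of_nonneg hx (by linarith)
    have h2 : w * h ≤ w * (r - v) := mul_le_mul_of_nonneg_left (by linarith) hw0
    have h3 : δ + w - x ≤ 1 :=
      abs_le_of_sq_le_sq' (by nlinarith [sq_nonneg (y + v)]) zero_le_one |>.2
    have h4 : v * (δ - w) ≤ v * (1 - 2 * w) := mul_le_mul_of_nonneg_left (by linarith) hv
    have h5 : v * (1 - 2 * w) ≤ r / 2 * (1 - 2 * w) :=
      mul_le_mul_of_nonneg_right (by linarith) (by linarith)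
    nlinarith
  · set k := √(x^2 + v^2) with hk
    have hk0 : 0 ≤ k := Real.sqrt_nonneg _
    have hk2 : k^2 = x^2 + v^2 := Real.sq_sqrt (by positivity)
    have hL2 : k^2 + w^2 + 2 * x * w + (y^2 + δ^2) ≤ 1 := by nlinarith
    set Y := √(1 - (k^2 + w^2 + 2 * x * w)) with hY
    have hY0 : 0 ≤ Y := Real.sqrt_nonneg _
    have hY2 : Y^2 = 1 - (k^2 + w^2 + 2 * x * w) := Real.sq_sqrt (by linarith [sq_nonneg y, sq_nonneg δ])
    have h1 : x * y + v * δ ≤ k * Y := by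
      refine abs_le_of_sq_le_sq' ?_ (by positivity) |>.2
      have : (k * Y)^2 = (x^2 + v^2) * Y^2 := by rw [mul_pow, hk2]
      rw [this]
      have h2 : (x^2 + v^2) * (y^2 + δ^2) ≤ (x^2 + v^2) * Y^2 :=
        mul_le_mul_of_nonneg_left (by linarith) (by positivity)
      nlinarith [sq_nonneg (x * δ - v * y)]
    suffices w * h + k * Y ≤ M by linarith
    rcases lt_or_ge (x^2) (h * v) with hhv | hhv
    · exact caseII hr0 hr hr1 hM hw0 hw1 hx hv hk2 (by linarith) hY2 hhr hhv
    · have hkr : k ≤ r := by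
        refine abs_le_of_sq_le_sq' ?_ hr0.le |>.2
        nlinarith
      have hgoal : ∀ c : ℝ, 0 ≤ c → c ≤ 1 → k * c = x → h ≤ c * √(r^2 - k^2) →
          w * h + k * Y ≤ M := by
        intro c hc0 hc1 hkc hh
        have e : √(k^2 + w^2 + 2 * x * w) ^ 2 = k^2 + w^2 + 2 * x * w := Real.sq_sqrt (by positivity)
        refine caseI (L := √(k^2 + w^2 + 2 * x * w)) hr0 hr hM hw0 hw1 hk0 hc0 hc1 ?_
          (Real.sqrt_nonneg _) ?_ ?_ hh
        · rw [e, ← hkc]; ring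
        · apply Real.sqrt_le_one.2; linarith [sq_nonneg y, sq_nonneg δ]
        · rw [e]
      have hg0 : 0 ≤ √(r^2 - k^2) := Real.sqrt_nonneg _
      rcases eq_or_lt_of_le hk0 with hk00 | hkpos
      · apply hgoal 1 zero_le_one le_rfl
        · have h0 : x^2 + v^2 = 0 := by rw [← hk2, ← hk00]; norm_num
          have h00 : x^2 = 0 := by linarith [sq_nonneg x, sq_nonneg v]
          have h000 : x = 0 := pow_eq_zero_iff (two_ne_zero) |>.1 h00
          rw [h000, ← hk00]; norm_num
        · rw [← hk00, show r^2 - 0^2 = r^2 by ring, Real.sqrt_sq hr0.le]; linarith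
      · apply hgoal (x / k) (by positivity)
        · rw [div_le_one hkpos]; exact abs_le_of_sq_le_sq' (by linarith [sq_nonneg v]) hk0 |>.2
        · field_simp
        · rw [div_mul_eq_mul_div, le_div_iff₀ hkpos]
          rcases le_total h 0 with hh0 | hh0
          · nlinarith [mul_nonneg hx hg0, mul_nonneg (neg_nonneg.2 hh0) hk0]
          · refine abs_le_of_sq_le_sq' ?_ (by positivity) |>.2
            have hrk : √(r^2 - k^2)^2 = r^2 - k^2 := Real.sq_sqrt (by linarith)
            rw [mul_pow, mul_pow, hrk, hk2]
            suffices (x^2 + v^2) * (x^2 + h^2) ≤ r^2 * x^2 by nlinarith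
            have key : (x^2 + v^2) * (x^2 + h^2) = (x^2 - h*v)^2 + x^2 * (h+v)^2 := by ring
            have key2 : (x^2 + v^2) * (x^2 + h^2) = (x^2 + h*v)^2 + x^2 * (h-v)^2 := by ring
            rcases le_total (s * x) (h * v) with hs | hs
            · have : (x^2 - h*v)^2 ≤ (x^2 - s*x)^2 := pow_le_pow_left₀ (by linarith) (by linarith) 2
              rw [key]
              nlinarith [mul_le_mul_of_nonneg_left hec (sq_nonneg x)]
            · have : (x^2 + h*v)^2 ≤ (x^2 + s*x)^2 := pow_le_pow_left₀ (by positivity) (by linarith) 2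
              rw [key2]
              nlinarith [mul_le_mul_of_nonneg_left heb (sq_nonneg x)]


abbrev E2 := EuclideanSpace ℝ (Fin 2)

lemma mp_prod : MeasurePreserving (fun z : E2 => ((z 0, z 1) : ℝ × ℝ)) volume volume := by
  have h1 := PiLp.volume_preserving_ofLp (Fin 2)
  exact (volume_preserving_finTwoArrow ℝ).comp h1

lemma int01 : ∫ x in (0:ℝ)..1, (1 - x) = 1 / 2 := by
  rw [intervalIntegral.integral_sub (by simp) (by simp)]
  simp
  norm_num

lemma vol_open : volume {z : E2 | 0 < z 0 ∧ 0 < z 1 ∧ z 0 + z 1 < 1} = ENNReal.ofReal (1/2) := by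
  have e : {z : E2 | 0 < z 0 ∧ 0 < z 1 ∧ z 0 + z 1 < 1} = 
    (fun z : E2 => ((z 0, z 1) : ℝ × ℝ)) ⁻¹' (regionBetween (fun _ => 0) (fun x => 1 - x) (Ioo 0 1)) := by
    ext z
    simp only [regionBetween, mem_ofPred_eq, mem_preimage, mem_Ioo]
    constructor
    · rintro ⟨h1, h2, h3⟩; exact ⟨⟨h1, by linarith⟩, h2, by linarith⟩
    · rintro ⟨⟨h1, _⟩, h2, h3⟩; exact ⟨h1, h2, by linarith⟩
  have hm : MeasurableSet (regionBetween (fun _ : ℝ => (0:ℝ)) (fun x => 1 - x) (Ioo 0 1)) :=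
    measurableSet_regionBetween (by fun_prop) (by fun_prop) measurableSet_Ioo
  rw [e, mp_prod.measure_preimage hm.nullMeasurableSet, Measure.volume_eq_prod,
    volume_regionBetween_eq_integral]
  · congr 1
    rw [← integral_Ioc_eq_integral_Ioo, ← intervalIntegral.integral_of_le zero_le_one]
    simpa using int01
  · exact integrableOn_zero
  · exact (continuous_const.sub continuous_id).integrableOn_Icc.mono_set Ioo_subset_Icc_self
  · exact measurableSet_Ioo
  · intro x hx; simp at hx ⊢; exact hx.2.le

lemma vol_closed : volume {z : E2 | 0 ≤ z 0 ∧ 0 ≤ z 1 ∧ z 0 + z 1 ≤ 1} = ENNReal.ofReal (1/2) := by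
  have e : {z : E2 | 0 ≤ z 0 ∧ 0 ≤ z 1 ∧ z 0 + z 1 ≤ 1} = 
    (fun z : E2 => ((z 0, z 1) : ℝ × ℝ)) ⁻¹' {p : ℝ × ℝ | 0 ≤ p.1 ∧ 0 ≤ p.2 ∧ p.1 + p.2 ≤ 1} := rfl
  have hm : MeasurableSet {p : ℝ × ℝ | 0 ≤ p.1 ∧ 0 ≤ p.2 ∧ p.1 + p.2 ≤ 1} := by
    apply IsClosed.measurableSet
    apply IsClosed.and (isClosed_le (by fun_prop) (by fun_prop))
    exact IsClosed.and (isClosed_le (by fun_prop) (by fun_prop)) (isClosed_le (by fun_prop) (by fun_prop))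
  rw [e, mp_prod.measure_preimage hm.nullMeasurableSet, Measure.volume_eq_prod,
    Measure.prod_apply hm]
  have f : ∀ x : ℝ, volume (Prod.mk x ⁻¹' {p : ℝ × ℝ | 0 ≤ p.1 ∧ 0 ≤ p.2 ∧ p.1 + p.2 ≤ 1}) = 
      (Icc (0:ℝ) 1).indicator (fun x => ENNReal.ofReal (1 - x)) x := by
    intro x
    by_cases hx : x ∈ Icc (0:ℝ) 1
    · rw [indicator_of_mem hx]
      have : Prod.mk x ⁻¹' {p : ℝ × ℝ | 0 ≤ p.1 ∧ 0 ≤ p.2 ∧ p.1 + p.2 ≤ 1} = Icc 0 (1 - x) := by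
        ext y; simp only [mem_preimage, mem_ofPred_eq, mem_Icc]
        constructor
        · rintro ⟨_, h2, h3⟩; exact ⟨h2, by linarith⟩
        · rintro ⟨h2, h3⟩; exact ⟨hx.1, h2, by linarith⟩
      rw [this, Real.volume_Icc, sub_zero]
    · rw [indicator_of_notMem hx]
      have : Prod.mk x ⁻¹' {p : ℝ × ℝ | 0 ≤ p.1 ∧ 0 ≤ p.2 ∧ p.1 + p.2 ≤ 1} = ∅ := by
        ext y; simp only [mem_preimage, mem_ofPred_eq, mem_empty_iff_false, iff_false]
        rintro ⟨h1, h2, h3⟩; exact hx ⟨h1, by linarith⟩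
      rw [this, measure_empty]
  simp_rw [f]
  rw [lintegral_indicator measurableSet_Icc, ← ofReal_integral_eq_lintegral_ofReal]
  · congr 1
    rw [integral_Icc_eq_integral_Ioc, ← intervalIntegral.integral_of_le zero_le_one]
    simpa using int01
  · exact (continuous_const.sub continuous_id).integrableOn_Icc
  · filter_upwards [ae_restrict_mem measurableSet_Icc] with x hx
    simp at hx ⊢; exact hx.2

/-- orientation -/
def orr (p q s : E2) : ℝ := (q 0 - p 0)*(s 1 - p 1) - (q 1 - p 1)*(s 0 - p 0)

/-- affine parametrization of a triangle -/
def para (p q s : E2) (z : E2) : E2 := p + (z 0 • (q - p) + z 1 • (s - p))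

lemma vol_para (p q s : E2) (S : Set E2) :
    volume (para p q s '' S) = ENNReal.ofReal |orr p q s| * volume S := by
  let f : E2 →ₗ[ℝ] E2 := Matrix.toEuclideanLin !![q 0 - p 0, s 0 - p 0; q 1 - p 1, s 1 - p 1]
  have hf : para p q s '' S = (fun z => p + z) '' (f '' S) := by
    rw [image_image]
    apply image_congr
    intro z _
    ext i
    fin_cases i <;> simp [para, f, Matrix.toEuclideanLin, Matrix.toLpLin, dotProduct, Fin.sum_univ_two] <;> ring
  have hd : LinearMap.det f = orr p q s := by
    simp only [f, Matrix.toEuclideanLin]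
    rw [LinearMap.det_toLpLin, Matrix.det_fin_two_of]
    simp [orr]; ring
  rw [hf, image_add_left, measure_preimage_add, Measure.addHaar_image_linearMap, hd]


lemma orr_rot (p q s : E2) : orr q s p = orr p q s := by simp only [orr]; ring
lemma orr_swap (p q s : E2) : orr p s q = - orr p q s := by simp only [orr]; ring

lemma orr_comb (p q z1 z2 : E2) {a b : ℝ} (hab : a + b = 1) :
    orr p q (a • z1 + b • z2) = a * orr p q z1 + b * orr p q z2 := by
  obtain rfl : a = 1 - b := by linarith
  simp only [orr, PiLp.add_apply, PiLp.smul_apply, smul_eq_mul]; ring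

lemma hull_half {p q : E2} {S : Set E2} (h : ∀ z ∈ S, 0 ≤ orr p q z) :
    ∀ z ∈ convexHull ℝ S, 0 ≤ orr p q z := by
  have : convexHull ℝ S ⊆ {z | 0 ≤ orr p q z} := by
    apply convexHull_min (fun z hz => h z hz)
    intro z1 h1 z2 h2 a b ha hb hab
    have h1' : 0 ≤ orr p q z1 := h1
    have h2' : 0 ≤ orr p q z2 := h2
    show 0 ≤ orr p q (a • z1 + b • z2)
    rw [orr_comb p q z1 z2 hab]
    positivity
  exact this

lemma para_comb (p q s z1 z2 : E2) {a b : ℝ} (hab : a + b = 1) :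
    para p q s (a • z1 + b • z2) = a • para p q s z1 + b • para p q s z2 := by
  obtain rfl : a = 1 - b := by linarith
  ext i
  simp only [para, PiLp.add_apply, PiLp.smul_apply, PiLp.sub_apply, smul_eq_mul]; ring

/-- closed standard triangle -/
def Tc : Set E2 := {z : E2 | 0 ≤ z 0 ∧ 0 ≤ z 1 ∧ z 0 + z 1 ≤ 1}
/-- open standard triangle -/
def To : Set E2 := {z : E2 | 0 < z 0 ∧ 0 < z 1 ∧ z 0 + z 1 < 1}

lemma vol_para_Tc (p q s : E2) : volume (para p q s '' Tc) = ENNReal.ofReal (|orr p q s| / 2) := by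
  rw [vol_para, Tc, vol_closed, ← ENNReal.ofReal_mul (abs_nonneg _)]
  congr 1; ring

lemma vol_para_To (p q s : E2) : volume (para p q s '' To) = ENNReal.ofReal (|orr p q s| / 2) := by
  rw [vol_para, To, vol_open, ← ENNReal.ofReal_mul (abs_nonneg _)]
  congr 1; ring

lemma para_mem_hull (p q s : E2) {z : E2} (hz : z ∈ Tc) : para p q s z ∈ convexHull ℝ {p, q, s} := by
  have hc := convex_convexHull ℝ ({p, q, s} : Set E2)
  obtain ⟨h0, h1, h2⟩ := hz
  have e : para p q s z = ∑ i : Fin 3, (![1 - z 0 - z 1, z 0, z 1] i) • (![p, q, s] i) := by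
    rw [Fin.sum_univ_three]
    ext i
    simp [para]; ring
  rw [e]
  apply hc.sum_mem
  · intro i _; fin_cases i <;> simp <;> linarith
  · rw [Fin.sum_univ_three]; simp; ring
  · intro i _; apply subset_convexHull; fin_cases i <;> simp

lemma hull_sub_para (p q s : E2) : convexHull ℝ {p, q, s} ⊆ para p q s '' Tc := by
  apply convexHull_min
  · rintro z (rfl | rfl | rfl)
    · refine ⟨0, by simp [Tc], by simp [para]⟩
    · refine ⟨!₂[1, 0], by simp [Tc], by simp [para]⟩
    · refine ⟨!₂[0, 1], by simp [Tc], by simp [para]⟩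
  · rintro _ ⟨z1, h1, rfl⟩ _ ⟨z2, h2, rfl⟩ a b ha hb hab
    refine ⟨a • z1 + b • z2, ?_, para_comb p q s z1 z2 hab⟩
    obtain ⟨h10, h11, h12⟩ := h1
    obtain ⟨h20, h21, h22⟩ := h2
    simp only [Tc, mem_ofPred_eq, PiLp.add_apply, PiLp.smul_apply, smul_eq_mul]
    refine ⟨by positivity, by positivity, ?_⟩
    nlinarith [mul_le_mul_of_nonneg_left h12 ha, mul_le_mul_of_nonneg_left h22 hb]

lemma mem_para {p q s z : E2} (h : 0 < orr p q s) (h1 : 0 ≤ orr p q z) (h2 : 0 ≤ orr q s z)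
    (h3 : 0 ≤ orr s p z) : z ∈ para p q s '' Tc := by
  refine ⟨!₂[orr s p z / orr p q s, orr p q z / orr p q s], ?_, ?_⟩
  · simp only [Tc, mem_ofPred_eq, Matrix.cons_val_zero, Matrix.cons_val_one]
    refine ⟨by positivity, by positivity, ?_⟩
    rw [← add_div, div_le_one h]
    have : orr s p z + orr p q z + orr q s z = orr p q s := by simp only [orr]; ring
    linarith
  · ext i
    simp only [para, PiLp.add_apply, PiLp.smul_apply, PiLp.sub_apply, smul_eq_mul, Matrix.cons_val_zero, Matrix.cons_val_one]
    have h' := h.ne'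
    field_simp
    fin_cases i <;> simp only [orr, Fin.zero_eta, Fin.mk_one] <;> ring

lemma mem_hull_of_orr {p q s z : E2} (h : 0 < orr p q s) (h1 : 0 ≤ orr p q z) (h2 : 0 ≤ orr q s z)
    (h3 : 0 ≤ orr s p z) : z ∈ convexHull ℝ {p, q, s} := by
  obtain ⟨y, hy, rfl⟩ := mem_para h h1 h2 h3
  exact para_mem_hull p q s hy

lemma tri_vol (p q s : E2) : volume (convexHull ℝ {p, q, s}) ≤ ENNReal.ofReal (|orr p q s| / 2) := by
  rw [← vol_para_Tc]; exact measure_mono (hull_sub_para p q s)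

lemma vol_para_pos {p q s : E2} (h : 0 < orr p q s) :
    volume (para p q s '' Tc) = ENNReal.ofReal (orr p q s / 2) := by
  rw [vol_para_Tc, abs_of_pos h]

lemma quad_vol {a b c d : E2} (abc : 0 < orr a b c) (abd : 0 < orr a b d) (acd : 0 < orr a c d)
    (bcd : 0 < orr b c d) :
    volume (convexHull ℝ {a, b, c, d}) ≤ ENNReal.ofReal ((orr a b c + orr a c d) / 2) := by
  have sub : convexHull ℝ {a, b, c, d} ⊆ para a b c '' Tc ∪ para a c d '' Tc := by
    intro z hz
    have hab : 0 ≤ orr a b z := hull_half (by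
      rintro z (rfl | rfl | rfl | rfl) <;> simp only [orr] at * <;> linarith) z hz
    have hbc : 0 ≤ orr b c z := hull_half (by
      rintro z (rfl | rfl | rfl | rfl) <;> simp only [orr] at * <;> linarith) z hz
    have hcd : 0 ≤ orr c d z := hull_half (by
      rintro z (rfl | rfl | rfl | rfl) <;> simp only [orr] at * <;> linarith) z hz
    have hda : 0 ≤ orr d a z := hull_half (by
      rintro z (rfl | rfl | rfl | rfl) <;> simp only [orr] at * <;> linarith) z hz
    rcases le_total 0 (orr a c z) with h | h
    · exact Or.inr (mem_para acd h hcd hda)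
    · refine Or.inl (mem_para abc hab hbc ?_)
      simp only [orr] at *; linarith
  refine (measure_mono sub).trans ((measure_union_le _ _).trans ?_)
  rw [vol_para_pos abc, vol_para_pos acd, ← ENNReal.ofReal_add (by positivity) (by positivity)]
  apply le_of_eq; congr 1; ring

lemma pent_vol {e a b c d : E2} (eab : 0 < orr e a b) (eac : 0 < orr e a c) (ead : 0 < orr e a d)
    (ebc : 0 < orr e b c) (ebd : 0 < orr e b d) (ecd : 0 < orr e c d)
    (abc : 0 < orr a b c) (abd : 0 < orr a b d) (acd : 0 < orr a c d) (bcd : 0 < orr b c d) :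
    volume (convexHull ℝ {e, a, b, c, d}) ≤
      ENNReal.ofReal ((orr e a b + orr e b c + orr e c d) / 2) := by
  have sub : convexHull ℝ {e, a, b, c, d} ⊆
      para e a b '' Tc ∪ (para e b c '' Tc ∪ para e c d '' Tc) := by
    intro z hz
    have hea : 0 ≤ orr e a z := hull_half (by
      rintro z (rfl | rfl | rfl | rfl | rfl) <;> simp only [orr] at * <;> linarith) z hz
    have hab : 0 ≤ orr a b z := hull_half (by
      rintro z (rfl | rfl | rfl | rfl | rfl) <;> simp only [orr] at * <;> linarith) z hz
    have hbc : 0 ≤ orr b c z := hull_half (by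
      rintro z (rfl | rfl | rfl | rfl | rfl) <;> simp only [orr] at * <;> linarith) z hz
    have hcd : 0 ≤ orr c d z := hull_half (by
      rintro z (rfl | rfl | rfl | rfl | rfl) <;> simp only [orr] at * <;> linarith) z hz
    have hde : 0 ≤ orr d e z := hull_half (by
      rintro z (rfl | rfl | rfl | rfl | rfl) <;> simp only [orr] at * <;> linarith) z hz
    rcases le_total 0 (orr e b z) with h | h
    · rcases le_total 0 (orr e c z) with h' | h'
      · exact Or.inr (Or.inr (mem_para ecd h' hcd hde))
      · refine Or.inr (Or.inl (mem_para ebc h hbc ?_))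
        simp only [orr] at *; linarith
    · refine Or.inl (mem_para eab hea hab ?_)
      simp only [orr] at *; linarith
  refine (measure_mono sub).trans ((measure_union_le _ _).trans
    ((add_le_add_right (measure_union_le _ _) _).trans ?_))
  rw [vol_para_pos eab, vol_para_pos ebc, vol_para_pos ecd,
    ← ENNReal.ofReal_add (by positivity) (by positivity),
    ← ENNReal.ofReal_add (by positivity) (by positivity)]
  apply le_of_eq; congr 1; ring


lemma coll_seg {a b c : E2} (h : orr a b c = 0) :
    a ∈ convexHull ℝ {b, c} ∨ b ∈ convexHull ℝ {a, c} ∨ c ∈ convexHull ℝ {a, b} := by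
  by_cases hab : a = b
  · subst hab; left; apply subset_convexHull; simp
  have hn : 0 < (b 0 - a 0)^2 + (b 1 - a 1)^2 := by
    by_contra hcon
    apply hab
    have h0 : b 0 - a 0 = 0 := by nlinarith [sq_nonneg (b 0 - a 0), sq_nonneg (b 1 - a 1)]
    have h1 : b 1 - a 1 = 0 := by nlinarith [sq_nonneg (b 0 - a 0), sq_nonneg (b 1 - a 1)]
    ext i; fin_cases i
    · simp; linarith
    · simp; linarith
  have hc : Collinear ℝ {a, b, c} := by
    rw [collinear_iff_of_mem (p₀ := a) (by simp)]
    refine ⟨b - a, ?_⟩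
    rintro z (rfl | rfl | rfl)
    · exact ⟨0, by simp⟩
    · exact ⟨1, by simp⟩
    · refine ⟨((z 0 - a 0) * (b 0 - a 0) + (z 1 - a 1) * (b 1 - a 1)) / ((b 0 - a 0)^2 + (b 1 - a 1)^2), ?_⟩
      ext i
      simp only [vadd_eq_add, PiLp.add_apply, PiLp.smul_apply, PiLp.sub_apply, smul_eq_mul]
      rw [← sub_eq_iff_eq_add, div_mul_eq_mul_div, eq_div_iff hn.ne']
      simp only [orr] at h
      fin_cases i <;> simp only [Fin.zero_eta, Fin.mk_one]
      · linear_combination -(b 1 - a 1) * h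
      · linear_combination (b 0 - a 0) * h
  have := hc.wbtw_or_wbtw_or_wbtw
  simp only [convexHull_pair, ← mem_segment_iff_wbtw] at *
  rcases this with h | h | h
  · exact Or.inr (Or.inl h)
  · right; right; rw [segment_symm]; exact h
  · left; rw [segment_symm]; exact h

/-- No point of the four lies in the hull of the other three. -/
def Conv4 (a b c d : E2) : Prop :=
  a ∉ convexHull ℝ {b, c, d} ∧ b ∉ convexHull ℝ {a, c, d} ∧
  c ∉ convexHull ℝ {a, b, d} ∧ d ∉ convexHull ℝ {a, b, c}

lemma nz_of {a b c d : E2} (ha : a ∉ convexHull ℝ {b, c, d}) (hb : b ∉ convexHull ℝ {a, c, d})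
    (hc : c ∉ convexHull ℝ {a, b, d}) : orr a b c ≠ 0 := by
  intro h
  rcases coll_seg h with h | h | h
  · exact ha (convexHull_mono (by intro z; simp; tauto) h)
  · exact hb (convexHull_mono (by intro z; simp; tauto) h)
  · exact hc (convexHull_mono (by intro z; simp; tauto) h)

lemma mem_hull_neg {p q s z : E2} (h : orr p q s < 0) (h1 : orr p q z ≤ 0) (h2 : orr q s z ≤ 0)
    (h3 : orr s p z ≤ 0) : z ∈ convexHull ℝ {p, q, s} := by
  have : z ∈ convexHull ℝ {p, s, q} := by
    apply mem_hull_of_orr <;> simp only [orr] at * <;> linarith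
  rwa [pair_comm s q] at this

lemma rot3 (x y z : E2) : ({x, y, z} : Set E2) = {z, x, y} := by
  ext w; simp only [mem_insert_iff, mem_singleton_iff]; tauto

lemma fourpt {a b c d : E2} (H : Conv4 a b c d) :
    (0 < orr b c d ∧ orr a c d < 0 ∧ orr a b d < 0 ∧ 0 < orr a b c) ∨
    (0 < orr b c d ∧ 0 < orr a c d ∧ 0 < orr a b d ∧ 0 < orr a b c) ∨
    (0 < orr b c d ∧ 0 < orr a c d ∧ orr a b d < 0 ∧ orr a b c < 0) ∨
    (orr b c d < 0 ∧ orr a c d < 0 ∧ 0 < orr a b d ∧ 0 < orr a b c) ∨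
    (orr b c d < 0 ∧ orr a c d < 0 ∧ orr a b d < 0 ∧ orr a b c < 0) ∨
    (orr b c d < 0 ∧ 0 < orr a c d ∧ 0 < orr a b d ∧ orr a b c < 0) := by
  obtain ⟨ha, hb, hc, hd⟩ := H
  have hid : orr b c d - orr a c d + orr a b d - orr a b c = 0 := by simp only [orr]; ring
  have n4 : orr a b c ≠ 0 := nz_of ha hb hc
  have n3 : orr a b d ≠ 0 := nz_of (c := d) (d := c) (by rwa [pair_comm]) (by rwa [pair_comm]) hd
  have n2 : orr a c d ≠ 0 := nz_of (d := b) (by rwa [rot3 c d b]) (by rwa [pair_comm d b])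
    (by rwa [pair_comm c b])
  have n1 : orr b c d ≠ 0 := nz_of (d := a) (by rwa [rot3 c d a]) (by rwa [rot3 b d a])
    (by rwa [rot3 b c a])
  have c1 := fun h1 h2 h3 h4 => hd (mem_hull_of_orr (p := a) (q := b) (s := c) (z := d) h1 h2 h3 h4)
  have c1n := fun h1 h2 h3 h4 => hd (mem_hull_neg (p := a) (q := b) (s := c) (z := d) h1 h2 h3 h4)
  have c2 := fun h1 h2 h3 h4 => hc (mem_hull_of_orr (p := a) (q := b) (s := d) (z := c) h1 h2 h3 h4)
  have c2n := fun h1 h2 h3 h4 => hc (mem_hull_neg (p := a) (q := b) (s := d) (z := c) h1 h2 h3 h4)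
  have c3 := fun h1 h2 h3 h4 => hb (mem_hull_of_orr (p := a) (q := c) (s := d) (z := b) h1 h2 h3 h4)
  have c3n := fun h1 h2 h3 h4 => hb (mem_hull_neg (p := a) (q := c) (s := d) (z := b) h1 h2 h3 h4)
  have c4 := fun h1 h2 h3 h4 => ha (mem_hull_of_orr (p := b) (q := c) (s := d) (z := a) h1 h2 h3 h4)
  have c4n := fun h1 h2 h3 h4 => ha (mem_hull_neg (p := b) (q := c) (s := d) (z := a) h1 h2 h3 h4)
  have e1 : orr c a d = - orr a c d := by simp only [orr]; ring
  have e2 : orr b d c = - orr b c d := by simp only [orr]; ring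
  have e3 : orr d a c = orr a c d := by simp only [orr]; ring
  have e4 : orr a c b = - orr a b c := by simp only [orr]; ring
  have e5 : orr c d b = orr b c d := by simp only [orr]; ring
  have e6 : orr d a b = orr a b d := by simp only [orr]; ring
  have e7 : orr b c a = orr a b c := by simp only [orr]; ring
  have e8 : orr c d a = orr a c d := by simp only [orr]; ring
  have e9 : orr d b a = - orr a b d := by simp only [orr]; ring
  rw [e1] at c1 c1n
  rw [e2, e3] at c2 c2n
  rw [e4, e5, e6] at c3 c3n
  rw [e7, e8, e9] at c4 c4n
  clear ha hb hc hd e1 e2 e3 e4 e5 e6 e7 e8 e9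
  generalize orr a b c = X4 at *
  generalize orr a b d = X3 at *
  generalize orr a c d = X2 at *
  generalize orr b c d = X1 at *
  rcases n1.lt_or_gt with h1 | h1 <;> rcases n2.lt_or_gt with h2 | h2 <;>
  rcases n3.lt_or_gt with h3 | h3 <;> rcases n4.lt_or_gt with h4 | h4 <;>
  first
  | exact Or.inl ⟨h1, h2, h3, h4⟩
  | exact Or.inr (Or.inl ⟨h1, h2, h3, h4⟩)
  | exact Or.inr (Or.inr (Or.inl ⟨h1, h2, h3, h4⟩))
  | exact Or.inr (Or.inr (Or.inr (Or.inl ⟨h1, h2, h3, h4⟩)))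
  | exact Or.inr (Or.inr (Or.inr (Or.inr (Or.inl ⟨h1, h2, h3, h4⟩))))
  | exact Or.inr (Or.inr (Or.inr (Or.inr (Or.inr ⟨h1, h2, h3, h4⟩))))
  | exact (c1 (by linarith only [h1, h2, h3, h4]) (by linarith only [h1, h2, h3, h4]) (by linarith only [h1, h2, h3, h4]) (by linarith only [h1, h2, h3, h4])).elim
  | exact (c1n (by linarith only [h1, h2, h3, h4]) (by linarith only [h1, h2, h3, h4]) (by linarith only [h1, h2, h3, h4]) (by linarith only [h1, h2, h3, h4])).elim
  | exact (c2 (by linarith only [h1, h2, h3, h4]) (by linarith only [h1, h2, h3, h4]) (by linarith only [h1, h2, h3, h4]) (by linarith only [h1, h2, h3, h4])).elim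
  | exact (c2n (by linarith only [h1, h2, h3, h4]) (by linarith only [h1, h2, h3, h4]) (by linarith only [h1, h2, h3, h4]) (by linarith only [h1, h2, h3, h4])).elim
  | exact (c3 (by linarith only [h1, h2, h3, h4]) (by linarith only [h1, h2, h3, h4]) (by linarith only [h1, h2, h3, h4]) (by linarith only [h1, h2, h3, h4])).elim
  | exact (c3n (by linarith only [h1, h2, h3, h4]) (by linarith only [h1, h2, h3, h4]) (by linarith only [h1, h2, h3, h4]) (by linarith only [h1, h2, h3, h4])).elim
  | exact (c4 (by linarith only [h1, h2, h3, h4]) (by linarith only [h1, h2, h3, h4]) (by linarith only [h1, h2, h3, h4]) (by linarith only [h1, h2, h3, h4])).elim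
  | exact (c4n (by linarith only [h1, h2, h3, h4]) (by linarith only [h1, h2, h3, h4]) (by linarith only [h1, h2, h3, h4]) (by linarith only [h1, h2, h3, h4])).elim
  | (exfalso; linarith only [h1, h2, h3, h4, hid])


lemma dist_sq2 (p q : E2) : dist p q ^ 2 = (p 0 - q 0)^2 + (p 1 - q 1)^2 := by
  rw [EuclideanSpace.dist_eq, Real.sq_sqrt (by positivity), Fin.sum_univ_two, Real.dist_eq,
    Real.dist_eq, sq_abs, sq_abs]

lemma dsq {p q : E2} {R : ℝ} (h : dist p q ≤ R) : (p 0 - q 0)^2 + (p 1 - q 1)^2 ≤ R ^ 2 := by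
  rw [← dist_sq2]; exact pow_le_pow_left₀ dist_nonneg h 2

lemma dist_le_of_sq {p q : E2} {R : ℝ} (hR : 0 ≤ R) (h : (p 0 - q 0)^2 + (p 1 - q 1)^2 ≤ R ^ 2) :
    dist p q ≤ R := by
  rw [← dist_sq2] at h; exact le_of_sq_le_sq h hR

/-- positively oriented convex quadrilateral -/
def Pos4 (a b c d : E2) : Prop := 0 < orr a b c ∧ 0 < orr a b d ∧ 0 < orr a c d ∧ 0 < orr b c d

/-- positively oriented convex pentagon -/
def Pos5 (e a b c d : E2) : Prop :=
  0 < orr e a b ∧ 0 < orr e a c ∧ 0 < orr e a d ∧ 0 < orr e b c ∧ 0 < orr e b d ∧ 0 < orr e c d ∧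
  Pos4 a b c d

lemma quad_order {a b c d : E2} (H : Conv4 a b c d) :
    ∃ a' b' c' d' : E2, ({a', b', c', d'} : Set E2) = {a, b, c, d} ∧ Pos4 a' b' c' d' := by
  unfold Pos4
  rcases fourpt H with h | h | h | h | h | h <;> obtain ⟨h1, h2, h3, h4⟩ := h
  · refine ⟨a, d, b, c, by ext w; simp only [mem_insert_iff, mem_singleton_iff]; tauto, ?_⟩
    simp only [orr] at *; refine ⟨?_, ?_, ?_, ?_⟩ <;> linarith
  · refine ⟨a, b, c, d, by ext w; simp only [mem_insert_iff, mem_singleton_iff], ?_⟩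
    simp only [orr] at *; refine ⟨?_, ?_, ?_, ?_⟩ <;> linarith
  · refine ⟨a, c, d, b, by ext w; simp only [mem_insert_iff, mem_singleton_iff]; tauto, ?_⟩
    simp only [orr] at *; refine ⟨?_, ?_, ?_, ?_⟩ <;> linarith
  · refine ⟨a, b, d, c, by ext w; simp only [mem_insert_iff, mem_singleton_iff]; tauto, ?_⟩
    simp only [orr] at *; refine ⟨?_, ?_, ?_, ?_⟩ <;> linarith
  · refine ⟨a, d, c, b, by ext w; simp only [mem_insert_iff, mem_singleton_iff]; tauto, ?_⟩
    simp only [orr] at *; refine ⟨?_, ?_, ?_, ?_⟩ <;> linarith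
  · refine ⟨a, c, b, d, by ext w; simp only [mem_insert_iff, mem_singleton_iff]; tauto, ?_⟩
    simp only [orr] at *; refine ⟨?_, ?_, ?_, ?_⟩ <;> linarith

lemma cross_le {x1 y1 x2 y2 : ℝ} (h1 : x1^2 + y1^2 ≤ 1) (h2 : x2^2 + y2^2 ≤ 1) :
    |x1 * y2 - y1 * x2| ≤ 1 := by
  rw [abs_le]
  constructor
  · nlinarith [sq_nonneg (x1 + y2), sq_nonneg (y1 - x2)]
  · nlinarith [sq_nonneg (x1 - y2), sq_nonneg (y1 + x2)]

lemma tri_half {p q s : E2} (h1 : dist p q ≤ 1) (h2 : dist p s ≤ 1) :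
    volume (convexHull ℝ {p, q, s}) ≤ ENNReal.ofReal (1 / 2) := by
  refine (tri_vol p q s).trans (ENNReal.ofReal_le_ofReal ?_)
  have := dsq h1
  have := dsq h2
  have : |orr p q s| ≤ 1 := by
    apply cross_le <;> nlinarith
  linarith

lemma hull_insert_mem {p : E2} {S : Set E2} (h : p ∈ convexHull ℝ S) :
    convexHull ℝ (insert p S) ⊆ convexHull ℝ S :=
  convexHull_min (insert_subset h (subset_convexHull ℝ S)) (convex_convexHull ℝ S)

lemma hull_le {p : E2} {S T : Set E2} (h : p ∈ convexHull ℝ S) (e : T = insert p S) :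
    volume (convexHull ℝ T) ≤ volume (convexHull ℝ S) := by
  subst e; exact measure_mono (hull_insert_mem h)

lemma four_vol {S : Set E2} {a b c d : E2} (hS : S = {a, b, c, d}) 
    (hd : ∀ p ∈ S, ∀ q ∈ S, dist p q ≤ 1) :
    volume (convexHull ℝ S) ≤ ENNReal.ofReal (1 / 2) := by
  have ma : a ∈ S := by simp [hS]
  have mb : b ∈ S := by simp [hS]
  have mc : c ∈ S := by simp [hS]
  have md : d ∈ S := by simp [hS]
  by_cases H : Conv4 a b c d
  · obtain ⟨a', b', c', d', e, h1, h2, h3, h4⟩ := quad_order H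
    rw [← hS] at e
    have ma' : a' ∈ S := by simp [← e]
    have mb' : b' ∈ S := by simp [← e]
    have mc' : c' ∈ S := by simp [← e]
    have md' : d' ∈ S := by simp [← e]
    rw [← e]
    refine (quad_vol h1 h2 h3 h4).trans (ENNReal.ofReal_le_ofReal ?_)
    have i1 := dsq (hd _ mc' _ ma')
    have i2 := dsq (hd _ md' _ mb')
    have := (abs_le.1 (cross_le (by linarith : (c' 0 - a' 0)^2 + (c' 1 - a' 1)^2 ≤ 1) 
      (by linarith : (d' 0 - b' 0)^2 + (d' 1 - b' 1)^2 ≤ 1))).2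
    simp only [orr]; linarith
  · simp only [Conv4, not_and_or, not_not] at H
    rcases H with h | h | h | h
    · exact (hull_le h hS).trans (tri_half (hd _ mb _ mc) (hd _ mb _ md))
    · exact (hull_le h (by rw [hS]; ext w; simp only [mem_insert_iff, mem_singleton_iff]; tauto)).trans
        (tri_half (hd _ ma _ mc) (hd _ ma _ md))
    · exact (hull_le h (by rw [hS]; ext w; simp only [mem_insert_iff, mem_singleton_iff]; tauto)).trans
        (tri_half (hd _ ma _ mb) (hd _ ma _ md))
    · exact (hull_le h (by rw [hS]; ext w; simp only [mem_insert_iff, mem_singleton_iff]; tauto)).trans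
        (tri_half (hd _ ma _ mb) (hd _ ma _ mc))

lemma quad_insert {e a b c d : E2} (H : Pos4 a b c d) (h1 : Conv4 a b c e) (h2 : Conv4 a b d e)
    (h3 : Conv4 a c d e) (h4 : Conv4 b c d e) :
    Pos5 e a b c d ∨ Pos5 e b c d a ∨ Pos5 e c d a b ∨ Pos5 e d a b c := by
  have key : ∀ p q : E2, orr e p q = orr p q e := fun p q => by simp only [orr]; ring
  have key' : ∀ p q : E2, orr q p e = - orr p q e := fun p q => by simp only [orr]; ring
  have r4 : Pos4 b c d a := by
    simp only [Pos4, orr] at *; obtain ⟨_, _, _, _⟩ := H; refine ⟨?_, ?_, ?_, ?_⟩ <;> linarith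
  have r5 : Pos4 c d a b := by
    simp only [Pos4, orr] at *; obtain ⟨_, _, _, _⟩ := H; refine ⟨?_, ?_, ?_, ?_⟩ <;> linarith
  have r6 : Pos4 d a b c := by
    simp only [Pos4, orr] at *; obtain ⟨_, _, _, _⟩ := H; refine ⟨?_, ?_, ?_, ?_⟩ <;> linarith
  have f1 := fourpt h1
  have f2 := fourpt h2
  have f3 := fourpt h3
  have f4 := fourpt h4
  simp only [Pos5, key, key' a b, key' a c, key' a d, key' b c, key' b d, key' c d, r4, r5, r6, H, and_true]
  obtain ⟨H1, H2, H3, H4⟩ := H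
  simp only [H1, H2, H3, H4, not_lt_of_gt, and_true, and_false, or_false, false_or] at f1 f2 f3 f4
  clear h1 h2 h3 h4 key key'
  generalize orr a b e = X1 at *
  generalize orr a c e = X2 at *
  generalize orr a d e = X3 at *
  generalize orr b c e = X4 at *
  generalize orr b d e = X5 at *
  generalize orr c d e = X6 at *
  simp only [Left.neg_pos_iff]
  clear r4 r5 r6 H1 H2 H3 H4
  rcases f1 with ⟨_, _, _⟩ | ⟨_, _, _⟩ | ⟨_, _, _⟩ <;>
  rcases f2 with ⟨_, _, _⟩ | ⟨_, _, _⟩ | ⟨_, _, _⟩ <;>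
  first
  | (exfalso; linarith)
  | (rcases f3 with ⟨_, _, _⟩ | ⟨_, _, _⟩ | ⟨_, _, _⟩ <;>
     first
     | (exfalso; linarith)
     | (rcases f4 with ⟨_, _, _⟩ | ⟨_, _, _⟩ | ⟨_, _, _⟩ <;>
        first
        | (exfalso; linarith)
        | (left; refine ⟨?_, ?_, ?_, ?_, ?_, ?_⟩ <;> assumption)
        | (right; left; refine ⟨?_, ?_, ?_, ?_, ?_, ?_⟩ <;> assumption)
        | (right; right; left; refine ⟨?_, ?_, ?_, ?_, ?_, ?_⟩ <;> assumption)
        | (right; right; right; refine ⟨?_, ?_, ?_, ?_, ?_, ?_⟩ <;> assumption)))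


lemma pent_frame {r M ea eb aa ab ba bb ca cb da db : ℝ} (hr0 : 0 < r) (hr : 1/2 < r^2) (hr1 : r ≤ 1)
    (hM : ∀ t, 0 ≤ t → t ≤ 1/2 → t * √(1-(t+1/2)^2) + 1/2*√(r^2-t^2) ≤ M)
    (h1 : ab = db) (h2 : aa < da) (hea : ab < eb) (hb : bb < ab) (hc : cb < ab)
    (dad : (da - aa)^2 + (db - ab)^2 ≤ 1) (dbc : (ba - ca)^2 + (bb - cb)^2 ≤ 1)
    (dac : (aa - ca)^2 + (ab - cb)^2 ≤ 1) (dbd : (ba - da)^2 + (bb - db)^2 ≤ 1)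
    (dab : (aa - ba)^2 + (ab - bb)^2 ≤ 1) (dcd : (ca - da)^2 + (cb - db)^2 ≤ 1)
    (deb : (ea - ba)^2 + (eb - bb)^2 ≤ r^2) (dec : (ea - ca)^2 + (eb - cb)^2 ≤ r^2) :
    (((aa - ea)*(bb - eb) - (ab - eb)*(ba - ea)) + ((ba - ea)*(cb - eb) - (bb - eb)*(ca - ea))
     + ((ca - ea)*(db - eb) - (cb - eb)*(da - ea)))/2 ≤ M := by
  subst h1
  have hw : (da - aa)/2 ≤ 1/2 := by nlinarith
  rcases le_total cb bb with hv | hv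
  · have := core (w := (da-aa)/2) (x := (ca-ba)/2) (v := (bb-cb)/2) (y := ab - (bb+cb)/2)
      (h := eb - (bb+cb)/2) (δ := (aa+da)/2 - (ba+ca)/2) (s := ea - (ba+ca)/2) hr0 hr hr1 hM
      (by linarith) hw (by linarith) (by linarith) (by linarith) (by linarith)
      (by linarith) (by linarith) (by linarith) (by linarith) (by linarith)
    linarith
  · have := core (w := (da-aa)/2) (x := (ca-ba)/2) (v := (cb-bb)/2) (y := ab - (bb+cb)/2)
      (h := eb - (bb+cb)/2) (δ := (ba+ca)/2 - (aa+da)/2) (s := (ba+ca)/2 - ea) hr0 hr hr1 hM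
      (by linarith) hw (by linarith) (by linarith) (by linarith) (by linarith)
      (by linarith) (by linarith) (by linarith) (by linarith) (by linarith)
    linarith

lemma rot_dist {u1 u2 R : ℝ} (hu : u1^2+u2^2 = 1) (p q : E2) (h : (p 0 - q 0)^2 + (p 1 - q 1)^2 ≤ R) :
    ((u1 * p 0 + u2 * p 1) - (u1 * q 0 + u2 * q 1))^2 +
    ((u1 * p 1 - u2 * p 0) - (u1 * q 1 - u2 * q 0))^2 ≤ R := by
  have : ((u1 * p 0 + u2 * p 1) - (u1 * q 0 + u2 * q 1))^2 +
    ((u1 * p 1 - u2 * p 0) - (u1 * q 1 - u2 * q 0))^2 = (u1^2+u2^2) * ((p 0 - q 0)^2 + (p 1 - q 1)^2) := by ring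
  rw [this, hu, one_mul]; exact h

lemma rot_orr {u1 u2 : ℝ} (hu : u1^2+u2^2 = 1) (p q s : E2) :
    ((u1 * q 0 + u2 * q 1) - (u1 * p 0 + u2 * p 1)) * ((u1 * s 1 - u2 * s 0) - (u1 * p 1 - u2 * p 0)) -
    ((u1 * q 1 - u2 * q 0) - (u1 * p 1 - u2 * p 0)) * ((u1 * s 0 + u2 * s 1) - (u1 * p 0 + u2 * p 1))
    = orr p q s := by
  rw [orr, ← one_mul ((q 0 - p 0)*(s 1 - p 1) - (q 1 - p 1)*(s 0 - p 0)), ← hu]; ring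

lemma pent_bound {r M : ℝ} {e a b c d : E2} (hr0 : 0 < r) (hr : 1/2 < r^2) (hr1 : r ≤ 1)
    (hM : ∀ t, 0 ≤ t → t ≤ 1/2 → t * √(1-(t+1/2)^2) + 1/2*√(r^2-t^2) ≤ M)
    (H : Pos5 e a b c d)
    (dad : dist d a ≤ 1) (dbc : dist b c ≤ 1) (dac : dist a c ≤ 1) (dbd : dist b d ≤ 1)
    (dab : dist a b ≤ 1) (dcd : dist c d ≤ 1) (deb : dist e b ≤ r) (dec : dist e c ≤ r) :
    (orr e a b + orr e b c + orr e c d) / 2 ≤ M := by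
  obtain ⟨eab, eac, ead, ebc, ebd, ecd, abc, abd, acd, bcd⟩ := H
  have hn : 0 < (d 0 - a 0)^2 + (d 1 - a 1)^2 := by
    by_contra hcon
    have h0 : d 0 - a 0 = 0 := by nlinarith [sq_nonneg (d 0 - a 0), sq_nonneg (d 1 - a 1)]
    have h1 : d 1 - a 1 = 0 := by nlinarith [sq_nonneg (d 0 - a 0), sq_nonneg (d 1 - a 1)]
    simp only [orr, h0, h1] at abd; linarith
  obtain ⟨n, hn0, hn2⟩ : ∃ n : ℝ, 0 < n ∧ n ^ 2 = (d 0 - a 0)^2 + (d 1 - a 1)^2 :=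
    ⟨√((d 0 - a 0)^2 + (d 1 - a 1)^2), Real.sqrt_pos.2 hn, Real.sq_sqrt hn.le⟩
  obtain ⟨u1, hu1⟩ : ∃ u1, u1 = (d 0 - a 0) / n := ⟨_, rfl⟩
  obtain ⟨u2, hu2⟩ : ∃ u2, u2 = (d 1 - a 1) / n := ⟨_, rfl⟩
  have hu : u1^2 + u2^2 = 1 := by
    rw [hu1, hu2, div_pow, div_pow, ← add_div, ← hn2, div_self (by positivity)]
  have e1 : d 0 - a 0 = n * u1 := by rw [hu1]; field_simp
  have e2 : d 1 - a 1 = n * u2 := by rw [hu2]; field_simp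
  have hX : (u1 * d 0 + u2 * d 1) - (u1 * a 0 + u2 * a 1) = n := by
    linear_combination u1 * e1 + u2 * e2 + n * hu
  have hY : (u1 * a 1 - u2 * a 0) = (u1 * d 1 - u2 * d 0) := by
    linear_combination - u1 * e2 + u2 * e1
  have t1 : ∀ z : E2, orr a z d = - n * ((u1 * z 1 - u2 * z 0) - (u1 * a 1 - u2 * a 0)) := by
    intro z; simp only [orr]; rw [e1, e2]; ring
  have q1 := t1 b
  have q2 := t1 c
  have q3 := t1 e
  have q4 : orr a e d = - orr e a d := by simp only [orr]; ring
  rw [← rot_orr hu e a b, ← rot_orr hu e b c, ← rot_orr hu e c d]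
  have one : (1:ℝ)^2 = 1 := by norm_num
  refine pent_frame hr0 hr hr1 hM hY (by linarith) ?_ ?_ ?_ 
    (rot_dist hu _ _ (one ▸ dsq dad)) (rot_dist hu _ _ (one ▸ dsq dbc)) (rot_dist hu _ _ (one ▸ dsq dac))
    (rot_dist hu _ _ (one ▸ dsq dbd)) (rot_dist hu _ _ (one ▸ dsq dab)) (rot_dist hu _ _ (one ▸ dsq dcd))
    (rot_dist hu _ _ (dsq deb)) (rot_dist hu _ _ (dsq dec))
  · have : 0 < n * ((u1 * e 1 - u2 * e 0) - (u1 * a 1 - u2 * a 0)) := by linarith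
    linarith [(mul_pos_iff_of_pos_left hn0).1 this]
  · have : 0 < n * ((u1 * a 1 - u2 * a 0) - (u1 * b 1 - u2 * b 0)) := by linarith
    linarith [(mul_pos_iff_of_pos_left hn0).1 this]
  · have : 0 < n * ((u1 * a 1 - u2 * a 0) - (u1 * c 1 - u2 * c 0)) := by linarith
    linarith [(mul_pos_iff_of_pos_left hn0).1 this]

/-- final estimate for an ordered pentagon -/
lemma pent_final {r M : ℝ} {S : Set E2} {e a b c d : E2} (hr0 : 0 < r) (hr : 1/2 < r^2) (hr1 : r ≤ 1)
    (hM : ∀ t, 0 ≤ t → t ≤ 1/2 → t * √(1-(t+1/2)^2) + 1/2*√(r^2-t^2) ≤ M)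
    (hS : S = {a, b, c, d}) (hd : ∀ p ∈ S, ∀ q ∈ S, dist p q ≤ 1) (he : ∀ p ∈ S, dist e p ≤ r)
    (H : Pos5 e a b c d) : volume (convexHull ℝ (insert e S)) ≤ ENNReal.ofReal M := by
  have ma : a ∈ S := by simp [hS]
  have mb : b ∈ S := by simp [hS]
  have mc : c ∈ S := by simp [hS]
  have md : d ∈ S := by simp [hS]
  have := pent_bound hr0 hr hr1 hM H (hd _ md _ ma) (hd _ mb _ mc) (hd _ ma _ mc) (hd _ mb _ md)
    (hd _ ma _ mb) (hd _ mc _ md) (he _ mb) (he _ mc)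
  obtain ⟨eab, eac, ead, ebc, ebd, ecd, abc, abd, acd, bcd⟩ := H
  rw [hS]
  exact (pent_vol eab eac ead ebc ebd ecd abc abd acd bcd).trans (ENNReal.ofReal_le_ofReal this)

lemma five_deg {r M : ℝ} {S : Set E2} {e p a b c d : E2} (hr : 1/2 < r^2) (hr1 : r ≤ 1)
    (hM : ∀ t, 0 ≤ t → t ≤ 1/2 → t * √(1-(t+1/2)^2) + 1/2*√(r^2-t^2) ≤ M)
    (hd : ∀ p ∈ S, ∀ q ∈ S, dist p q ≤ 1) (he : ∀ p ∈ S, dist e p ≤ r)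
    (hS : insert e S = {p, a, b, c, d}) (hp : p ∈ convexHull ℝ {a, b, c, d}) :
    volume (convexHull ℝ (insert e S)) ≤ ENNReal.ofReal M := by
  have hhalf : ENNReal.ofReal (1/2) ≤ ENNReal.ofReal M := ENNReal.ofReal_le_ofReal (half_le_M hr hM).2
  have hd' : ∀ p ∈ insert e S, ∀ q ∈ insert e S, dist p q ≤ 1 := by
    intro p hp q hq
    rcases hp with hp1 | hp1 <;> rcases hq with hq1 | hq1
    · rw [hp1, hq1]; simp
    · rw [hp1]; exact (he _ hq1).trans hr1
    · rw [hq1, dist_comm]; exact (he _ hp1).trans hr1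
    · exact hd _ hp1 _ hq1
  refine ((hull_le hp hS).trans (four_vol rfl (fun x hx y hy => hd' x ?_ y ?_))).trans hhalf
  · rw [hS]; exact mem_insert_of_mem _ hx
  · rw [hS]; exact mem_insert_of_mem _ hy

lemma not_hull_mono {p : E2} {T U : Set E2} (h1 : p ∉ convexHull ℝ T) (h2 : U ⊆ T) :
    p ∉ convexHull ℝ U := fun h3 => h1 (convexHull_mono h2 h3)

lemma upper_pos {r M : ℝ} {S : Set E2} {e a b c d : E2} (hr0 : 0 < r) (hr : 1/2 < r^2) (hr1 : r ≤ 1)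
    (hM : ∀ t, 0 ≤ t → t ≤ 1/2 → t * √(1-(t+1/2)^2) + 1/2*√(r^2-t^2) ≤ M)
    (hS : S = {a, b, c, d}) (hd : ∀ p ∈ S, ∀ q ∈ S, dist p q ≤ 1) (he : ∀ p ∈ S, dist e p ≤ r)
    (H : Pos4 a b c d) :
    volume (convexHull ℝ (insert e S)) ≤ ENNReal.ofReal M := by
  by_cases ne : e ∈ convexHull ℝ {a, b, c, d}
  · exact five_deg hr hr1 hM hd he (by rw [hS]) ne
  by_cases na : a ∈ convexHull ℝ {e, b, c, d}
  · exact five_deg hr hr1 hM hd he (by rw [hS]; ext w; simp only [mem_insert_iff, mem_singleton_iff]; tauto) na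
  by_cases nb : b ∈ convexHull ℝ {e, a, c, d}
  · exact five_deg hr hr1 hM hd he (by rw [hS]; ext w; simp only [mem_insert_iff, mem_singleton_iff]; tauto) nb
  by_cases nc : c ∈ convexHull ℝ {e, a, b, d}
  · exact five_deg hr hr1 hM hd he (by rw [hS]; ext w; simp only [mem_insert_iff, mem_singleton_iff]; tauto) nc
  by_cases nd : d ∈ convexHull ℝ {e, a, b, c}
  · exact five_deg hr hr1 hM hd he (by rw [hS]; ext w; simp only [mem_insert_iff, mem_singleton_iff]; tauto) nd
  have q1 : Conv4 a b c e := by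
    refine ⟨not_hull_mono na ?_, not_hull_mono nb ?_, not_hull_mono nc ?_, not_hull_mono ne ?_⟩ <;>
    · intro w; simp only [mem_insert_iff, mem_singleton_iff]; tauto
  have q2 : Conv4 a b d e := by
    refine ⟨not_hull_mono na ?_, not_hull_mono nb ?_, not_hull_mono nd ?_, not_hull_mono ne ?_⟩ <;>
    · intro w; simp only [mem_insert_iff, mem_singleton_iff]; tauto
  have q3 : Conv4 a c d e := by
    refine ⟨not_hull_mono na ?_, not_hull_mono nc ?_, not_hull_mono nd ?_, not_hull_mono ne ?_⟩ <;>
    · intro w; simp only [mem_insert_iff, mem_singleton_iff]; tauto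
  have q4 : Conv4 b c d e := by
    refine ⟨not_hull_mono nb ?_, not_hull_mono nc ?_, not_hull_mono nd ?_, not_hull_mono ne ?_⟩ <;>
    · intro w; simp only [mem_insert_iff, mem_singleton_iff]; tauto
  rcases quad_insert H q1 q2 q3 q4 with h | h | h | h
  · exact pent_final hr0 hr hr1 hM hS hd he h
  · exact pent_final hr0 hr hr1 hM (by rw [hS]; ext w; simp only [mem_insert_iff, mem_singleton_iff]; tauto) hd he h
  · exact pent_final hr0 hr hr1 hM (by rw [hS]; ext w; simp only [mem_insert_iff, mem_singleton_iff]; tauto) hd he h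
  · exact pent_final hr0 hr hr1 hM (by rw [hS]; ext w; simp only [mem_insert_iff, mem_singleton_iff]; tauto) hd he h

lemma upper {r M : ℝ} {S : Set E2} {e a b c d : E2} (hr0 : 0 < r) (hr : 1/2 < r^2) (hr1 : r ≤ 1)
    (hM : ∀ t, 0 ≤ t → t ≤ 1/2 → t * √(1-(t+1/2)^2) + 1/2*√(r^2-t^2) ≤ M)
    (hS : S = {a, b, c, d}) (hd : ∀ p ∈ S, ∀ q ∈ S, dist p q ≤ 1) (he : ∀ p ∈ S, dist e p ≤ r) :
    volume (convexHull ℝ (insert e S)) ≤ ENNReal.ofReal M := by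
  by_cases H : Conv4 a b c d
  · obtain ⟨a', b', c', d', eS, P4⟩ := quad_order H
    exact upper_pos hr0 hr hr1 hM (hS.trans eS.symm) hd he P4
  · simp only [Conv4, not_and_or, not_not] at H
    rcases H with h | h | h | h
    · exact five_deg hr hr1 hM hd he (by rw [hS]; ext w; simp only [mem_insert_iff, mem_singleton_iff]; tauto)
        (convexHull_mono (subset_insert e _) h)
    · exact five_deg hr hr1 hM hd he (by rw [hS]; ext w; simp only [mem_insert_iff, mem_singleton_iff]; tauto)
        (convexHull_mono (subset_insert e _) h)
    · exact five_deg hr hr1 hM hd he (by rw [hS]; ext w; simp only [mem_insert_iff, mem_singleton_iff]; tauto)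
        (convexHull_mono (subset_insert e _) h)
    · exact five_deg hr hr1 hM hd he (by rw [hS]; ext w; simp only [mem_insert_iff, mem_singleton_iff]; tauto)
        (convexHull_mono (subset_insert e _) h)


lemma sep_vol {s t H U : Set E2} (hU : MeasurableSet U) (hs : s ⊆ H) (ht : t ⊆ H)
    (hsU : s ⊆ U) (htU : ∀ z ∈ t, z ∉ U) : volume s + volume t ≤ volume H := by
  rw [← measure_inter_add_sdiff H hU]
  exact add_le_add (measure_mono (subset_inter hs hsU)) (measure_mono (fun z hz => ⟨ht hz, htU z hz⟩))

lemma lower_vol {x y h : ℝ} (hx : 0 ≤ x) (hy : 0 ≤ y) (hh : 0 < h) :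
    ENNReal.ofReal (x * y + h / 2) ≤ volume (convexHull ℝ
      ({!₂[-1/2, y], !₂[-x, 0], !₂[x, 0], !₂[1/2, y], !₂[0, h]} : Set E2)) := by
  set S : Set E2 := {!₂[-1/2, y], !₂[-x, 0], !₂[x, 0], !₂[1/2, y], !₂[0, h]} with hS
  have h0 : (0 : E2) ∈ convexHull ℝ S := by
    have : (0 : E2) = (1/2 : ℝ) • !₂[-x, 0] + (1/2 : ℝ) • !₂[x, 0] := by
      ext i; fin_cases i <;> simp
    rw [this]
    exact (convex_convexHull ℝ S) (subset_convexHull ℝ S (by simp [hS])) (subset_convexHull ℝ S (by simp [hS]))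
      (by norm_num) (by norm_num) (by norm_num)
  have sub : ∀ p ∈ S, ∀ q ∈ S, para 0 p q '' To ⊆ convexHull ℝ S := by
    rintro p hp q hq _ ⟨z, hz, rfl⟩
    have hz' : z ∈ Tc := ⟨hz.1.le, hz.2.1.le, hz.2.2.le⟩
    refine convexHull_min ?_ (convex_convexHull ℝ S) (para_mem_hull 0 p q hz')
    rintro w (rfl | rfl | rfl)
    · exact h0
    · exact subset_convexHull ℝ S hp
    · exact subset_convexHull ℝ S hq
  have m1 : !₂[-1/2, y] ∈ S := by simp [hS]
  have m2 : !₂[-x, 0] ∈ S := by simp [hS]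
  have m3 : !₂[x, 0] ∈ S := by simp [hS]
  have m4 : !₂[1/2, y] ∈ S := by simp [hS]
  have m5 : !₂[0, h] ∈ S := by simp [hS]
  have v1 := vol_para_To 0 !₂[1/2, y] !₂[0, h]
  have v2 := vol_para_To 0 !₂[x, 0] !₂[1/2, y]
  have v3 := vol_para_To 0 !₂[0, h] !₂[-1/2, y]
  have v4 := vol_para_To 0 !₂[-1/2, y] !₂[-x, 0]
  have o1 : |orr 0 !₂[1/2, y] !₂[0, h]| = h / 2 := by
    rw [abs_of_nonneg] <;> simp [orr]; ring; positivity
  have o2 : |orr 0 !₂[x, 0] !₂[1/2, y]| = x * y := by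
    rw [abs_of_nonneg] <;> simp [orr]; positivity
  have o3 : |orr 0 !₂[0, h] !₂[-1/2, y]| = h / 2 := by
    rw [abs_of_nonneg] <;> simp [orr]; ring; linarith
  have o4 : |orr 0 !₂[-1/2, y] !₂[-x, 0]| = x * y := by
    rw [abs_of_nonneg] <;> simp [orr]; ring; positivity
  rw [o1] at v1; rw [o2] at v2; rw [o3] at v3; rw [o4] at v4
  have mU1 : MeasurableSet {z : E2 | y * z 0 < 1/2 * z 1} := 
    (isOpen_lt (by fun_prop) (by fun_prop)).measurableSet
  have mU2 : MeasurableSet {z : E2 | - y * z 0 < 1/2 * z 1} := 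
    (isOpen_lt (by fun_prop) (by fun_prop)).measurableSet
  have mU3 : MeasurableSet {z : E2 | 0 < z 0} := 
    (isOpen_lt (by fun_prop) (by fun_prop)).measurableSet
  have p0 : ∀ (p q z : E2) (i : Fin 2), para 0 p q z i = z 0 * p i + z 1 * q i := by
    intro p q z i; simp [para]
  have r12 := sep_vol (s := para 0 !₂[1/2, y] !₂[0, h] '' To) (t := para 0 !₂[x, 0] !₂[1/2, y] '' To)
    (H := convexHull ℝ S ∩ {z : E2 | 0 < z 0}) mU1 
    (by
      refine subset_inter (sub _ m4 _ m5) ?_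
      rintro _ ⟨z, ⟨z0, z1, z2⟩, rfl⟩
      show 0 < para 0 _ _ z 0
      rw [p0]; simp; linarith)
    (by
      refine subset_inter (sub _ m3 _ m4) ?_
      rintro _ ⟨z, ⟨z0, z1, z2⟩, rfl⟩
      show 0 < para 0 _ _ z 0
      rw [p0]; simp; positivity)
    (by
      rintro _ ⟨z, ⟨z0, z1, z2⟩, rfl⟩
      show y * para 0 _ _ z 0 < 1/2 * para 0 _ _ z 1
      rw [p0, p0]; simp; nlinarith [mul_pos z1 hh])
    (by
      rintro _ ⟨z, ⟨z0, z1, z2⟩, rfl⟩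
      show ¬ (y * para 0 _ _ z 0 < 1/2 * para 0 _ _ z 1)
      rw [p0, p0]; simp; nlinarith [mul_nonneg z0.le (mul_nonneg hx hy)])
  have r34 := sep_vol (s := para 0 !₂[0, h] !₂[-1/2, y] '' To) (t := para 0 !₂[-1/2, y] !₂[-x, 0] '' To)
    (H := convexHull ℝ S ∩ {z : E2 | z 0 < 0}) mU2 
    (by
      refine subset_inter (sub _ m5 _ m1) ?_
      rintro _ ⟨z, ⟨z0, z1, z2⟩, rfl⟩
      show para 0 _ _ z 0 < 0
      rw [p0]; simp; linarith)
    (by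
      refine subset_inter (sub _ m1 _ m2) ?_
      rintro _ ⟨z, ⟨z0, z1, z2⟩, rfl⟩
      show para 0 _ _ z 0 < 0
      rw [p0]; simp; nlinarith)
    (by
      rintro _ ⟨z, ⟨z0, z1, z2⟩, rfl⟩
      show - y * para 0 _ _ z 0 < 1/2 * para 0 _ _ z 1
      rw [p0, p0]; simp; nlinarith [mul_pos z0 hh])
    (by
      rintro _ ⟨z, ⟨z0, z1, z2⟩, rfl⟩
      show ¬ (- y * para 0 _ _ z 0 < 1/2 * para 0 _ _ z 1)
      rw [p0, p0]; simp; nlinarith [mul_nonneg z1.le (mul_nonneg hx hy)])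
  have r := sep_vol (s := convexHull ℝ S ∩ {z : E2 | 0 < z 0}) (t := convexHull ℝ S ∩ {z : E2 | z 0 < 0})
    (H := convexHull ℝ S) mU3 inter_subset_left inter_subset_left inter_subset_right 
    (fun z hz h => absurd (show 0 < z 0 from h) (not_lt_of_gt hz.2))
  refine le_trans ?_ ((add_le_add r12 r34).trans r)
  rw [v1, v2, v3, v4, ← ENNReal.ofReal_add (by positivity) (by positivity),
    ← ENNReal.ofReal_add (by positivity) (by positivity)]
  apply le_of_eq; congr 1; ring

lemma A_eq (r t : ℝ) : A r t = t * √(1-(t+1/2)^2) + 1/2*√(r^2-t^2) := by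
  have : √(3 - 4*t - 4*t^2) = 2 * √(1-(t+1/2)^2) := by
    rw [show 3 - 4*t - 4*t^2 = 2^2 * (1-(t+1/2)^2) by ring, Real.sqrt_mul (by norm_num),
      Real.sqrt_sq (by norm_num)]
  rw [A, this]; ring

lemma feas_ineq {r x y h : ℝ} (hr : 1/2 < r^2) (hx : 0 ≤ x) (hx1 : x ≤ 1/2)
    (hy0 : 0 ≤ y) (hh0 : 0 ≤ h) (hy : y^2 = 1 - (x+1/2)^2) (hh : h^2 = r^2 - x^2) :
    1/4 + (h - y)^2 ≤ r^2 := by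
  obtain ⟨k, hk0, hk⟩ : ∃ k : ℝ, 0 ≤ k ∧ k^2 = r^2 - 1/4 :=
    ⟨√(r^2-1/4), Real.sqrt_nonneg _, Real.sq_sqrt (by linarith)⟩
  have h1 : h ≤ y + k := by
    apply le_of_sq_le_sq _ (by positivity)
    nlinarith [mul_nonneg hy0 hk0]
  have h2 : y ≤ h + k := by
    apply le_of_sq_le_sq _ (by positivity)
    nlinarith [mul_nonneg hh0 hk0]
  nlinarith

lemma feas {r x y h : ℝ} (hr0 : 0 < r) (hx0 : 0 ≤ x) (hx1 : x ≤ 1/2)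
    (hy : y^2 = 1 - (x+1/2)^2) (hh : h^2 = r^2 - x^2) (hf : 1/4 + (h - y)^2 ≤ r^2) :
    dist (!₂[0, h] : E2) !₂[-1/2, y] ≤ r ∧
    dist (!₂[0, h] : E2) !₂[-x, 0] ≤ r ∧
    dist (!₂[0, h] : E2) !₂[x, 0] ≤ r ∧
    dist (!₂[0, h] : E2) !₂[1/2, y] ≤ r ∧
    dist (!₂[-1/2, y] : E2) !₂[-x, 0] ≤ 1 ∧
    dist (!₂[-1/2, y] : E2) !₂[x, 0] ≤ 1 ∧
    dist (!₂[-1/2, y] : E2) !₂[1/2, y] ≤ 1 ∧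
    dist (!₂[-x, 0] : E2) !₂[x, 0] ≤ 1 ∧
    dist (!₂[-x, 0] : E2) !₂[1/2, y] ≤ 1 ∧
    dist (!₂[x, 0] : E2) !₂[1/2, y] ≤ 1 := by
  have one : (0:ℝ) ≤ 1 := zero_le_one
  have c1 : dist (!₂[0, h] : E2) !₂[-1/2, y] ≤ r := dist_le_of_sq hr0.le (by simp; nlinarith)
  have c2 : dist (!₂[0, h] : E2) !₂[-x, 0] ≤ r := dist_le_of_sq hr0.le (by simp; nlinarith)
  have c3 : dist (!₂[0, h] : E2) !₂[x, 0] ≤ r := dist_le_of_sq hr0.le (by simp; nlinarith)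
  have c4 : dist (!₂[0, h] : E2) !₂[1/2, y] ≤ r := dist_le_of_sq hr0.le (by simp; nlinarith)
  have d12 : dist (!₂[-1/2, y] : E2) !₂[-x, 0] ≤ 1 := dist_le_of_sq one (by simp; nlinarith)
  have d13 : dist (!₂[-1/2, y] : E2) !₂[x, 0] ≤ 1 := dist_le_of_sq one (by simp; nlinarith)
  have d14 : dist (!₂[-1/2, y] : E2) !₂[1/2, y] ≤ 1 := dist_le_of_sq one (by simp; norm_num)
  have d23 : dist (!₂[-x, 0] : E2) !₂[x, 0] ≤ 1 := dist_le_of_sq one (by simp; rw [abs_le]; constructor <;> linarith)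
  have d24 : dist (!₂[-x, 0] : E2) !₂[1/2, y] ≤ 1 := dist_le_of_sq one (by simp; nlinarith)
  have d34 : dist (!₂[x, 0] : E2) !₂[1/2, y] ≤ 1 := dist_le_of_sq one (by simp; nlinarith)
  exact ⟨c1, c2, c3, c4, d12, d13, d14, d23, d24, d34⟩

theorem stmt_11 (r : ℝ) (hr : (Real.sqrt 2)⁻¹ < r) (hr1 : r ≤ 1) :
    sSup {v : ℝ | ∃ P₁ P₂ P₃ P₄ P₅ : EuclideanSpace ℝ (Fin 2),
        dist P₅ P₁ ≤ r ∧ dist P₅ P₂ ≤ r ∧ dist P₅ P₃ ≤ r ∧ dist P₅ P₄ ≤ r ∧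
        dist P₁ P₂ ≤ 1 ∧ dist P₁ P₃ ≤ 1 ∧ dist P₁ P₄ ≤ 1 ∧
        dist P₂ P₃ ≤ 1 ∧ dist P₂ P₄ ≤ 1 ∧ dist P₃ P₄ ≤ 1 ∧
        v = (volume (convexHull ℝ
            ({P₁, P₂, P₃, P₄, P₅} : Set (EuclideanSpace ℝ (Fin 2))))).toReal} =
      sSup (A r '' Set.Icc (0 : ℝ) (1 / 2)) := by
  have hs : 0 < (Real.sqrt 2)⁻¹ := by positivity
  have hr0 : 0 < r := hs.trans hr
  have hr2 : 1/2 < r^2 := by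
    have := pow_lt_pow_left₀ hr hs.le (two_ne_zero)
    rw [inv_pow, Real.sq_sqrt (by norm_num)] at this
    linarith
  have hcont : Continuous (A r) := by unfold A; fun_prop
  have hbdd : BddAbove (A r '' Set.Icc (0 : ℝ) (1 / 2)) :=
    (isCompact_Icc.image hcont).bddAbove
  obtain ⟨M, hMdef⟩ : ∃ M, M = sSup (A r '' Set.Icc (0 : ℝ) (1 / 2)) := ⟨_, rfl⟩
  have hM : ∀ t, 0 ≤ t → t ≤ 1/2 → t * √(1-(t+1/2)^2) + 1/2*√(r^2-t^2) ≤ M := by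
    intro t h0 h1
    rw [← A_eq, hMdef]
    exact le_csSup hbdd ⟨t, ⟨h0, h1⟩, rfl⟩
  have hM0 : 0 ≤ M := by linarith [(half_le_M hr2 hM).2]
  rw [← hMdef]
  have hup : ∀ P₁ P₂ P₃ P₄ P₅ : E2, 
        dist P₅ P₁ ≤ r → dist P₅ P₂ ≤ r → dist P₅ P₃ ≤ r → dist P₅ P₄ ≤ r →
        dist P₁ P₂ ≤ 1 → dist P₁ P₃ ≤ 1 → dist P₁ P₄ ≤ 1 →
        dist P₂ P₃ ≤ 1 → dist P₂ P₄ ≤ 1 → dist P₃ P₄ ≤ 1 → 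
        volume (convexHull ℝ ({P₁, P₂, P₃, P₄, P₅} : Set E2)) ≤ ENNReal.ofReal M := by
    intro P₁ P₂ P₃ P₄ P₅ e1 e2 e3 e4 h12 h13 h14 h23 h24 h34
    have := upper (S := {P₁, P₂, P₃, P₄}) (e := P₅) hr0 hr2 hr1 hM rfl
      (by
        intro p hp q hq
        simp only [mem_insert_iff, mem_singleton_iff] at hp hq
        rcases hp with hp | hp | hp | hp <;> rcases hq with hq | hq | hq | hq <;> rw [hp, hq] <;>
        first
        | assumption
        | (rw [dist_comm]; assumption)
        | (rw [dist_self]; norm_num))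
      (by
        intro p hp
        simp only [mem_insert_iff, mem_singleton_iff] at hp
        rcases hp with hp | hp | hp | hp <;> rw [hp] <;> assumption)
    rwa [show ({P₁, P₂, P₃, P₄, P₅} : Set E2) = insert P₅ {P₁, P₂, P₃, P₄} by
      ext w; simp only [mem_insert_iff, mem_singleton_iff]; tauto]
  have hub : ∀ v ∈ {v : ℝ | ∃ P₁ P₂ P₃ P₄ P₅ : EuclideanSpace ℝ (Fin 2),
        dist P₅ P₁ ≤ r ∧ dist P₅ P₂ ≤ r ∧ dist P₅ P₃ ≤ r ∧ dist P₅ P₄ ≤ r ∧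
        dist P₁ P₂ ≤ 1 ∧ dist P₁ P₃ ≤ 1 ∧ dist P₁ P₄ ≤ 1 ∧
        dist P₂ P₃ ≤ 1 ∧ dist P₂ P₄ ≤ 1 ∧ dist P₃ P₄ ≤ 1 ∧
        v = (volume (convexHull ℝ
            ({P₁, P₂, P₃, P₄, P₅} : Set (EuclideanSpace ℝ (Fin 2))))).toReal}, v ≤ M := by
    rintro v ⟨P₁, P₂, P₃, P₄, P₅, e1, e2, e3, e4, h12, h13, h14, h23, h24, h34, rfl⟩
    exact ENNReal.toReal_le_of_le_ofReal hM0 (hup _ _ _ _ _ e1 e2 e3 e4 h12 h13 h14 h23 h24 h34)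
  apply le_antisymm
  · have z : dist (0 : E2) 0 ≤ r := by rw [dist_self]; exact hr0.le
    have z1 : dist (0 : E2) 0 ≤ 1 := by rw [dist_self]; exact zero_le_one
    exact csSup_le ⟨(volume (convexHull ℝ ({0, 0, 0, 0, 0} : Set E2))).toReal,
      0, 0, 0, 0, 0, z, z, z, z, z1, z1, z1, z1, z1, z1, rfl⟩ hub
  · rw [hMdef]
    apply csSup_le (Set.Nonempty.image _ ⟨0, by norm_num⟩)
    rintro _ ⟨x, ⟨hx0, hx1⟩, rfl⟩
    obtain ⟨y, hy0, hy, hy'⟩ : ∃ y : ℝ, 0 ≤ y ∧ y^2 = 1-(x+1/2)^2 ∧ y = √(1-(x+1/2)^2) :=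
      ⟨_, Real.sqrt_nonneg _, Real.sq_sqrt (by nlinarith), rfl⟩
    obtain ⟨h, hh0, hh, hh'⟩ : ∃ h : ℝ, 0 < h ∧ h^2 = r^2-x^2 ∧ h = √(r^2-x^2) :=
      ⟨_, Real.sqrt_pos.2 (by nlinarith), Real.sq_sqrt (by nlinarith), rfl⟩
    have hf := feas_ineq hr2 hx0 hx1 hy0 hh0.le hy hh
    have lo := lower_vol hx0 hy0 hh0
    rw [A_eq, ← hy', ← hh']
    obtain ⟨c1, c2, c3, c4, d12, d13, d14, d23, d24, d34⟩ := feas hr0 hx0 hx1 hy hh hf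
    refine le_trans ?_ (le_csSup ⟨M, hub⟩ ⟨_, _, _, _, _, c1, c2, c3, c4, d12, d13, d14, d23, d24, d34, rfl⟩)
    have fin : volume (convexHull ℝ
      ({!₂[-1/2, y], !₂[-x, 0], !₂[x, 0], !₂[1/2, y], !₂[0, h]} : Set E2)) ≠ ⊤ :=
      ne_top_of_le_ne_top ENNReal.ofReal_ne_top (hup _ _ _ _ _ c1 c2 c3 c4 d12 d13 d14 d23 d24 d34)
    have := (ENNReal.ofReal_le_iff_le_toReal fin).1 lo
    linarith
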